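/- The 988 × 988 matrix GS([A1], [A2], [A3], [A4]) built by substituting the circulant matrices [A1], [A2], [A3], [A4] into the Goethals–Seidel array is a skew-Hadamard matrix of order 988; that is, all its entries are ±1, it satisfies M · Mᵀ = 988 · I_988, and M + Mᵀ = 2 · I_988. -/

import Mathlib

open Finset Matrix

/-- The subgroup H of order 9 of the multiplicative group of `ZMod 247`. -/
def H : Finset (ZMod 247) := {1, 9, 16, 55, 61, 81, 139, 144, 235}

/-- Representatives of the even-indexed orbits. -/
def rep : List (ZMod 247) := [1, 2, 3, 5, 6, 7, 10, 11, 13, 14, 17, 19, 33, 35, 38]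

/-- The orbits `α i`: `α (2*i) = rep[i] • H` and `α (2*i+1) = -α (2*i)`. -/
def alpha (i : ℕ) : Finset (ZMod 247) :=
  if i % 2 = 0 then H.image (fun h => rep.getD (i / 2) 0 * h)
  else (H.image (fun h => rep.getD (i / 2) 0 * h)).image (fun x => -x)

def A1 : Finset (ZMod 247) := ({0, 2, 4, 7, 8, 10, 12, 15, 16, 18, 20, 23, 25, 27, 29} : Finset ℕ).biUnion alpha
def A2 : Finset (ZMod 247) := ({0, 2, 7, 9, 11, 12, 14, 15, 16, 18, 20, 22, 26} : Finset ℕ).biUnion alpha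
def A3 : Finset (ZMod 247) := ({2, 3, 4, 12, 13, 14, 15, 16, 18, 20, 23, 24, 26, 27, 29} : Finset ℕ).biUnion alpha
def A4 : Finset (ZMod 247) := ({0, 3, 4, 6, 10, 11, 12, 14, 18, 19, 20, 22, 25, 29} : Finset ℕ).biUnion alpha

/-- The circulant {±1}-matrix `[X]` associated to `X ⊆ ZMod 247`. -/
def circ (X : Finset (ZMod 247)) : Matrix (ZMod 247) (ZMod 247) ℤ :=
  Matrix.of fun i j => if j - i ∈ X then -1 else 1

/-- The back-diagonal permutation matrix `R`. -/
def R : Matrix (ZMod 247) (ZMod 247) ℤ :=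
  Matrix.of fun i j => if i + j = (246 : ZMod 247) then 1 else 0

/-- The Goethals–Seidel array. -/
def GS (P1 P2 P3 P4 : Matrix (ZMod 247) (ZMod 247) ℤ) :
    Matrix (Fin 4 × ZMod 247) (Fin 4 × ZMod 247) ℤ :=
  Matrix.of fun p q =>
    (![![P1, P2 * R, P3 * R, P4 * R],
       ![-(P2 * R), P1, -(P4ᵀ * R), P3ᵀ * R],
       ![-(P3 * R), P4ᵀ * R, P1, -(P2ᵀ * R)],
       ![-(P4 * R), -(P3ᵀ * R), P2ᵀ * R, P1]] p.1 q.1) p.2 q.2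
/-- The `±1`-valued function on `ZMod 247` which is `-1` exactly at the binary digits `1` of `m`. -/
def bitSign (m : ℕ) (k : ZMod 247) : ℤ := bif m.testBit k.val then -1 else 1

/-- The periodic autocorrelation function of `f`. -/
def autocorrelation (f : ZMod 247 → ℤ) (s : ZMod 247) : ℤ := ∑ k, f k * f (k + s)

/-- The natural numbers whose binary digits are the indicator functions of `A1`, `A2`, `A3`, `A4`. -/
def mask : Fin 4 → ℕ :=
  ![22258662162780282922560454145407936493989615081711336651291885159209985742,
    12533885828745557902425191066058067865704952333242760558813191085625437958,
    71006558602897047309105703325217512995929854051840387762603597291437059084,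
    72517916818678767284971150142130398860327911880985938147469357358698450602]

theorem mem_A1 : ∀ k, k ∈ A1 ↔ (mask 0).testBit k.val = true := by decide +kernel

theorem mem_A2 : ∀ k, k ∈ A2 ↔ (mask 1).testBit k.val = true := by decide +kernel

theorem mem_A3 : ∀ k, k ∈ A3 ↔ (mask 2).testBit k.val = true := by decide +kernel

theorem mem_A4 : ∀ k, k ∈ A4 ↔ (mask 3).testBit k.val = true := by decide +kernel

theorem bitSign_neg_add : ∀ k ≠ 0, bitSign (mask 0) k + bitSign (mask 0) (-k) = 0 := by
  decide +kernel

theorem bitSign_zero : bitSign (mask 0) 0 = 1 := by decide +kernel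

theorem bitSign_mul : ∀ i, ∀ h ∈ H, ∀ k, bitSign (mask i) (h * k) = bitSign (mask i) k := by
  decide +kernel

theorem pow_nine_eq_one : ∀ h ∈ H, h ^ 9 = 1 := by decide +kernel

theorem exists_rep_mul : ∀ s : ZMod 247, s ≠ 0 →
    ∃ r ∈ rep, ∃ h ∈ H, s = h * r ∨ s = -(h * r) := by
  decide +kernel

theorem sum_autocorrelation_rep :
    ∀ r ∈ rep, ∑ i, autocorrelation (bitSign (mask i)) r = 0 := by
  decide +kernel

theorem bitSign_eq_or (m : ℕ) (k : ZMod 247) : bitSign m k = 1 ∨ bitSign m k = -1 := by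
  unfold bitSign
  cases m.testBit k.val <;> simp

theorem autocorrelation_neg (f : ZMod 247 → ℤ) (s : ZMod 247) :
    autocorrelation f (-s) = autocorrelation f s := by
  unfold autocorrelation
  rw [← Equiv.sum_comp (Equiv.addRight s)]
  simp [mul_comm]

theorem autocorrelation_mul (f : ZMod 247 → ℤ) {h : ZMod 247} (hu : IsUnit h)
    (hf : ∀ k, f (h * k) = f k) (s : ZMod 247) :
    autocorrelation f (h * s) = autocorrelation f s := by
  obtain ⟨u, rfl⟩ := hu
  unfold autocorrelation
  rw [← Equiv.sum_comp (Units.mulLeft u)]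
  simp [← mul_add, hf]

theorem autocorrelation_bitSign_zero (m : ℕ) : autocorrelation (bitSign m) 0 = 247 := by
  have h (k : ZMod 247) : bitSign m k * bitSign m k = 1 := by
    rcases bitSign_eq_or m k with h | h <;> simp [h]
  simp [autocorrelation, h]

theorem sum_autocorrelation (s : ZMod 247) :
    ∑ i, autocorrelation (bitSign (mask i)) s = if s = 0 then 988 else 0 := by
  split_ifs with hs
  · simp [hs, autocorrelation_bitSign_zero]
  · obtain ⟨r, hr, h, hh, hs⟩ := exists_rep_mul s hs
    have hu : IsUnit h := IsUnit.of_pow_eq_one (pow_nine_eq_one h hh) (by decide)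
    rw [← sum_autocorrelation_rep r hr]
    refine Finset.sum_congr rfl fun i _ => ?_
    have key := autocorrelation_mul _ hu (bitSign_mul i h hh) r
    rcases hs with rfl | rfl
    · exact key
    · rw [autocorrelation_neg, key]

theorem circulant_mul_transpose_apply (f : ZMod 247 → ℤ) (i j : ZMod 247) :
    (circulant f * (circulant f)ᵀ) i j = autocorrelation f (j - i) := by
  rw [autocorrelation, mul_apply, ← Equiv.sum_comp (Equiv.subLeft i)]
  refine Finset.sum_congr rfl fun k _ => ?_
  simp only [Equiv.subLeft_apply, circulant_apply, transpose_apply]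
  congr 2 <;> abel

theorem circ_eq_circulant {X : Finset (ZMod 247)} {m : ℕ}
    (hX : ∀ k, k ∈ X ↔ m.testBit k.val = true) : circ X = (circulant (bitSign m))ᵀ := by
  ext i j
  simp only [circ, of_apply, transpose_apply, circulant_apply, bitSign, hX]
  cases m.testBit (j - i).val <;> simp

theorem mul_R_apply (M : Matrix (ZMod 247) (ZMod 247) ℤ) (i j : ZMod 247) :
    (M * R) i j = M i (246 - j) := by
  simp [mul_apply, R, ← eq_sub_iff_add_eq]

theorem R_transpose : Rᵀ = R := by
  ext i j
  simp [R, add_comm]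

theorem R_mul_R : R * R = 1 := by
  ext i j
  rw [mul_R_apply]
  simp only [R, of_apply, one_apply, add_sub_left_comm, add_eq_left, sub_eq_zero]

theorem R_mul_circulant (f : ZMod 247 → ℤ) : R * circulant f = (circulant f)ᵀ * R := by
  ext i j
  rw [mul_R_apply, mul_apply]
  simp only [R, of_apply, ite_mul, one_mul, zero_mul, ← eq_sub_iff_add_eq']
  simp [circulant_apply, sub_right_comm]

theorem R_mul_circulant_transpose (f : ZMod 247 → ℤ) :
    R * (circulant f)ᵀ = circulant f * R := by
  rw [transpose_circulant, R_mul_circulant, transpose_circulant]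
  simp

theorem circulant_transpose_mul_comm (f g : ZMod 247 → ℤ) :
    (circulant f)ᵀ * circulant g = circulant g * (circulant f)ᵀ := by
  rw [transpose_circulant, circulant_mul_comm]

/-- The blocks of the Goethals–Seidel array. -/
def gsBlocks (P1 P2 P3 P4 : Matrix (ZMod 247) (ZMod 247) ℤ) :
    Matrix (Fin 4) (Fin 4) (Matrix (ZMod 247) (ZMod 247) ℤ) :=
  !![P1, P2 * R, P3 * R, P4 * R;
     -(P2 * R), P1, -(P4ᵀ * R), P3ᵀ * R;
     -(P3 * R), P4ᵀ * R, P1, -(P2ᵀ * R);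
     -(P4 * R), -(P3ᵀ * R), P2ᵀ * R, P1]

theorem GS_apply (P1 P2 P3 P4 : Matrix (ZMod 247) (ZMod 247) ℤ) (p q : Fin 4 × ZMod 247) :
    GS P1 P2 P3 P4 p q = gsBlocks P1 P2 P3 P4 p.1 q.1 p.2 q.2 := rfl

theorem GS_mul_transpose_apply (P1 P2 P3 P4 : Matrix (ZMod 247) (ZMod 247) ℤ)
    (p q : Fin 4 × ZMod 247) :
    (GS P1 P2 P3 P4 * (GS P1 P2 P3 P4)ᵀ) p q =
      (∑ k, gsBlocks P1 P2 P3 P4 p.1 k * (gsBlocks P1 P2 P3 P4 q.1 k)ᵀ) p.2 q.2 := by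
  simp only [mul_apply, transpose_apply, GS_apply, Fintype.sum_prod_type, Matrix.sum_apply]

theorem sum_gsBlocks_mul_transpose (f : Fin 4 → ZMod 247 → ℤ) (p q : Fin 4) :
    ∑ k, gsBlocks (circulant (f 0))ᵀ (circulant (f 1))ᵀ (circulant (f 2))ᵀ (circulant (f 3))ᵀ p k *
      (gsBlocks (circulant (f 0))ᵀ (circulant (f 1))ᵀ (circulant (f 2))ᵀ (circulant (f 3))ᵀ q k)ᵀ =
    if p = q then ∑ i, circulant (f i) * (circulant (f i))ᵀ else 0 := by
  have comm (i j) : circulant (f i) * circulant (f j) = circulant (f j) * circulant (f i) :=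
    circulant_mul_comm _ _
  have comm_transpose (i j) : (circulant (f i))ᵀ * (circulant (f j))ᵀ =
      (circulant (f j))ᵀ * (circulant (f i))ᵀ := by
    rw [← transpose_mul, circulant_mul_comm, transpose_mul]
  have R_mul_assoc (i) (M : Matrix (ZMod 247) (ZMod 247) ℤ) :
      R * (circulant (f i) * M) = (circulant (f i))ᵀ * (R * M) := by
    rw [← mul_assoc, R_mul_circulant, mul_assoc]
  have R_mul_transpose_assoc (i) (M : Matrix (ZMod 247) (ZMod 247) ℤ) :
      R * ((circulant (f i))ᵀ * M) = circulant (f i) * (R * M) := by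
    rw [← mul_assoc, R_mul_circulant_transpose, mul_assoc]
  have comm_assoc (i j) (M : Matrix (ZMod 247) (ZMod 247) ℤ) :
      (circulant (f i))ᵀ * (circulant (f j) * M) = circulant (f j) * ((circulant (f i))ᵀ * M) := by
    rw [← mul_assoc, circulant_transpose_mul_comm, mul_assoc]
  have left_comm_transpose (i j) (M : Matrix (ZMod 247) (ZMod 247) ℤ) :
      (circulant (f i))ᵀ * ((circulant (f j))ᵀ * M) =
        (circulant (f j))ᵀ * ((circulant (f i))ᵀ * M) := by
    rw [← mul_assoc, comm_transpose, mul_assoc]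
  fin_cases p <;> fin_cases q <;>
    simp [gsBlocks, Fin.sum_univ_four, R_transpose, mul_assoc, R_mul_R, 
      R_mul_circulant, R_mul_circulant_transpose, R_mul_assoc, R_mul_transpose_assoc,
      circulant_transpose_mul_comm, comm_assoc] <;>
    (try simp only [comm, left_comm_transpose, comm_transpose]) <;> abel

theorem GS_eq : GS (circ A1) (circ A2) (circ A3) (circ A4) =
    GS (circulant (bitSign (mask 0)))ᵀ (circulant (bitSign (mask 1)))ᵀ
      (circulant (bitSign (mask 2)))ᵀ (circulant (bitSign (mask 3)))ᵀ := by
  rw [circ_eq_circulant mem_A1, circ_eq_circulant mem_A2, circ_eq_circulant mem_A3,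
    circ_eq_circulant mem_A4]

theorem circulant_bitSign_add_transpose :
    circulant (bitSign (mask 0)) + (circulant (bitSign (mask 0)))ᵀ = (2 : ℤ) • 1 := by
  ext i j
  by_cases h : i = j
  · simp [h, bitSign_zero]
  · have := bitSign_neg_add (i - j) (sub_ne_zero.2 h)
    rw [neg_sub] at this
    simp [h, this]

theorem gsBlocks_add_transpose (f : Fin 4 → ZMod 247 → ℤ) (p q : Fin 4) :
    gsBlocks (circulant (f 0))ᵀ (circulant (f 1))ᵀ (circulant (f 2))ᵀ (circulant (f 3))ᵀ p q +
      (gsBlocks (circulant (f 0))ᵀ (circulant (f 1))ᵀ (circulant (f 2))ᵀ (circulant (f 3))ᵀ q p)ᵀ =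
    if p = q then circulant (f 0) + (circulant (f 0))ᵀ else 0 := by
  fin_cases p <;> fin_cases q <;>
    simp [gsBlocks, R_transpose, R_mul_circulant, R_mul_circulant_transpose, add_comm]

theorem mul_R_eq_one_or {M : Matrix (ZMod 247) (ZMod 247) ℤ}
    (hM : ∀ i j, M i j = 1 ∨ M i j = -1) (i j : ZMod 247) :
    (M * R) i j = 1 ∨ (M * R) i j = -1 := by
  rw [mul_R_apply]
  exact hM _ _

theorem neg_eq_one_or {M : Matrix (ZMod 247) (ZMod 247) ℤ}
    (hM : ∀ i j, M i j = 1 ∨ M i j = -1) (i j : ZMod 247) :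
    (-M) i j = 1 ∨ (-M) i j = -1 := by
  rw [neg_apply, neg_inj, neg_eq_iff_eq_neg]
  exact (hM i j).symm

theorem gsBlocks_eq_one_or {P1 P2 P3 P4 : Matrix (ZMod 247) (ZMod 247) ℤ}
    (h1 : ∀ i j, P1 i j = 1 ∨ P1 i j = -1) (h2 : ∀ i j, P2 i j = 1 ∨ P2 i j = -1)
    (h3 : ∀ i j, P3 i j = 1 ∨ P3 i j = -1) (h4 : ∀ i j, P4 i j = 1 ∨ P4 i j = -1)
    (p q : Fin 4) (i j : ZMod 247) :
    gsBlocks P1 P2 P3 P4 p q i j = 1 ∨ gsBlocks P1 P2 P3 P4 p q i j = -1 := by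
  have t2 := mul_R_eq_one_or fun i j => h2 j i
  have t3 := mul_R_eq_one_or fun i j => h3 j i
  have t4 := mul_R_eq_one_or fun i j => h4 j i
  replace h2 := mul_R_eq_one_or h2
  replace h3 := mul_R_eq_one_or h3
  replace h4 := mul_R_eq_one_or h4
  fin_cases p
  · fin_cases q
    exacts [h1 i j, h2 i j, h3 i j, h4 i j]
  · fin_cases q
    exacts [neg_eq_one_or h2 i j, h1 i j, neg_eq_one_or t4 i j, t3 i j]
  · fin_cases q
    exacts [neg_eq_one_or h3 i j, t4 i j, h1 i j, neg_eq_one_or t2 i j]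
  · fin_cases q
    exacts [neg_eq_one_or h4 i j, neg_eq_one_or t3 i j, t2 i j, h1 i j]

theorem gs_skew_hadamard_A :
    (∀ p q, GS (circ A1) (circ A2) (circ A3) (circ A4) p q = 1 ∨
            GS (circ A1) (circ A2) (circ A3) (circ A4) p q = -1) ∧
    GS (circ A1) (circ A2) (circ A3) (circ A4) *
      (GS (circ A1) (circ A2) (circ A3) (circ A4))ᵀ = (988 : ℤ) • 1 ∧
    GS (circ A1) (circ A2) (circ A3) (circ A4) +
      (GS (circ A1) (circ A2) (circ A3) (circ A4))ᵀ = (2 : ℤ) • 1 := by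
  rw [GS_eq]
  refine ⟨?_, ?_, ?_⟩
  · have h (m) (i j : ZMod 247) :
        (circulant (bitSign m))ᵀ i j = 1 ∨ (circulant (bitSign m))ᵀ i j = -1 :=
      bitSign_eq_or m (j - i)
    exact fun p q => gsBlocks_eq_one_or (h _) (h _) (h _) (h _) p.1 q.1 p.2 q.2
  · ext ⟨p, i⟩ ⟨q, j⟩
    rw [GS_mul_transpose_apply, sum_gsBlocks_mul_transpose fun i => bitSign (mask i)]
    by_cases h : p = q
    · simp only [if_pos h, Matrix.sum_apply, circulant_mul_transpose_apply, sum_autocorrelation]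
      simp [one_apply, h, sub_eq_zero, eq_comm]
    · simp [h]
  · ext ⟨p, i⟩ ⟨q, j⟩
    have h := congr_fun₂ (gsBlocks_add_transpose (fun i => bitSign (mask i)) p q) i j
    rw [circulant_bitSign_add_transpose] at h
    refine h.trans ?_
    by_cases hpq : p = q
    · simp [one_apply, hpq]
    · simp [hpq]
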